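/- Corollary 1 (full-dimension case p = n): Let f : S^n → ℝ be convex and twice continuously differentiable with gradient ∇f(X) ∈ S^n. Suppose Y ∈ ℝ^{n×n} is a local minimizer of Y' ↦ f(Y'Y'ᵀ) on {Y' ∈ ℝ^{n×n} : Tr(Y'ᵀ A_i Y') = b_i, i = 1,…,m} and the matrices A_1 Y, …, A_m Y are linearly independent. Then X = YYᵀ is a global minimizer of the convex program (P). -/

import Mathlib

open Matrix BigOperators

attribute [local instance] Matrix.normedAddCommGroup Matrix.normedSpace

open Filter Topology

section

variable {n ι : Type*} [Fintype n] [Fintype ι]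

/-- The linear map `H ↦ H Yᵀ + Y Hᵀ`, which is the derivative of `Z ↦ Z Zᵀ` at `Y`. -/
noncomputable def mulTransposeDeriv (Y : Matrix n n ℝ) : Matrix n n ℝ →L[ℝ] Matrix n n ℝ :=
  LinearMap.toContinuousLinearMap
    { toFun := fun H => H * Yᵀ + Y * Hᵀ
      map_add' := fun H K => by
        simp only [transpose_add, Matrix.mul_add, Matrix.add_mul]
        abel
      map_smul' := fun c H => by simp }

@[simp]
theorem mulTransposeDeriv_apply (Y H : Matrix n n ℝ) :
    mulTransposeDeriv Y H = H * Yᵀ + Y * Hᵀ := rfl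

theorem hasStrictFDerivAt_mul_transpose_self (Y : Matrix n n ℝ) :
    HasStrictFDerivAt (fun Z : Matrix n n ℝ => Z * Zᵀ) (mulTransposeDeriv Y) Y := by
  let B : Matrix n n ℝ →ₗ[ℝ] Matrix n n ℝ →ₗ[ℝ] Matrix n n ℝ :=
    LinearMap.mk₂ ℝ (fun P Q => P * Qᵀ) (fun _ _ _ => Matrix.add_mul _ _ _)
      (fun _ _ _ => by simp) (fun _ _ _ => by simp [Matrix.mul_add]) (fun _ _ _ => by simp)
  have h := B.toContinuousBilinearMap.hasStrictFDerivAt_of_bilinear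
    (hasStrictFDerivAt_id Y) (hasStrictFDerivAt_id Y)
  refine h.congr_fderiv ?_
  ext1 H
  change Y * Hᵀ + H * Yᵀ = H * Yᵀ + Y * Hᵀ
  abel

/-- The linear functional `H ↦ Tr (B H)`. -/
noncomputable def traceMulLeft (B : Matrix n n ℝ) : Matrix n n ℝ →L[ℝ] ℝ :=
  LinearMap.toContinuousLinearMap
    { toFun := fun H => (B * H).trace
      map_add' := fun H K => by simp [Matrix.mul_add]
      map_smul' := fun c H => by simp }

@[simp]
theorem traceMulLeft_apply (B H : Matrix n n ℝ) : traceMulLeft B H = (B * H).trace := rfl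

theorem trace_mul_mulTransposeDeriv {B : Matrix n n ℝ} (hB : B.IsSymm) (Y H : Matrix n n ℝ) :
    (B * mulTransposeDeriv Y H).trace = 2 * (B * Y * Hᵀ).trace := by
  have h : (B * (H * Yᵀ)).trace = (B * Y * Hᵀ).trace := by
    rw [← trace_transpose, transpose_mul, transpose_mul, transpose_transpose, hB.eq,
      Matrix.trace_mul_comm, ← Matrix.mul_assoc]
  rw [mulTransposeDeriv_apply, Matrix.mul_add, trace_add, h, ← Matrix.mul_assoc]
  ring

theorem eq_zero_of_trace_mul_transpose_self {C : Matrix n n ℝ} (h : (C * Cᵀ).trace = 0) :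
    C = 0 := by
  rwa [← conjTranspose_eq_transpose_of_trivial, trace_mul_conjTranspose_self_eq_zero_iff] at h

theorem trace_transpose_mul_mul (B Z : Matrix n n ℝ) :
    (Zᵀ * B * Z).trace = (B * (Z * Zᵀ)).trace := by
  rw [Matrix.mul_assoc, Matrix.trace_mul_comm, Matrix.mul_assoc]

/-- A `C²` function has the strict derivative `H ↦ Tr (G H)` wherever these are its directional
derivatives. -/
theorem hasStrictFDerivAt_traceMulLeft {f : Matrix n n ℝ → ℝ} {X G : Matrix n n ℝ}
    (hf : ContDiff ℝ 2 f)
    (hG : ∀ H, HasDerivAt (fun t : ℝ => f (X + t • H)) ((G * H).trace) 0) :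
    HasStrictFDerivAt f (traceMulLeft G) X := by
  have h := hf.contDiffAt.hasStrictFDerivAt (x := X) (by norm_num)
  refine h.congr_fderiv ?_
  ext1 H
  exact (h.hasFDerivAt.hasLineDerivAt H).unique (hG H)

/-- A convex function lies above its linearization. -/
theorem ConvexOn.add_trace_le {f : Matrix n n ℝ → ℝ} (hf : ConvexOn ℝ Set.univ f)
    {X G : Matrix n n ℝ} (H : Matrix n n ℝ)
    (hG : HasDerivAt (fun t : ℝ => f (X + t • H)) ((G * H).trace) 0) :
    f X + (G * H).trace ≤ f (X + H) := by
  have hc : ConvexOn ℝ Set.univ (fun t : ℝ => f (X + t • H)) := by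
    refine ⟨convex_univ, fun s _ t _ a c ha hc hac => ?_⟩
    have h := hf.2 (Set.mem_univ (X + s • H)) (Set.mem_univ (X + t • H)) ha hc hac
    convert h using 2
    simp only [smul_eq_mul]
    linear_combination (norm := module) -(hac • X)
  have h := hc.le_slope_of_hasDerivAt (Set.mem_univ 0) (Set.mem_univ 1) one_pos hG
  simp [slope_def_field] at h
  linarith

/-- First-order conditions for the factorized program. -/
theorem exists_multipliers_mul_eq_zero {A : ι → Matrix n n ℝ} {b : ι → ℝ}
    (hA : ∀ i, (A i).IsSymm) {f : Matrix n n ℝ → ℝ} {Y G : Matrix n n ℝ} (hGs : G.IsSymm)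
    (hG : HasStrictFDerivAt f (traceMulLeft G) (Y * Yᵀ))
    (hfeas : ∀ i, (A i * (Y * Yᵀ)).trace = b i)
    (hmin : IsLocalMinOn (fun Z : Matrix n n ℝ => f (Z * Zᵀ))
      {Z | ∀ i, (A i * (Z * Zᵀ)).trace = b i} Y)
    (hindep : LinearIndependent ℝ (fun i => A i * Y)) :
    ∃ l : ι → ℝ, (G - ∑ i, l i • A i) * Y = 0 := by
  have hsq := hasStrictFDerivAt_mul_transpose_self Y
  have hq (i : ι) := (traceMulLeft (A i)).hasStrictFDerivAt.comp Y hsq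
  have hmin' : IsLocalExtrOn (f ∘ fun Z : Matrix n n ℝ => Z * Zᵀ)
      {Z | ∀ i, (traceMulLeft (A i) ∘ fun Z : Matrix n n ℝ => Z * Zᵀ) Z =
        (traceMulLeft (A i) ∘ fun Z : Matrix n n ℝ => Z * Zᵀ) Y} Y := by
    left
    simp only [Function.comp_def, traceMulLeft_apply, hfeas]
    exact hmin
  obtain ⟨l, l₀, hne, hsum⟩ :=
    hmin'.exists_multipliers_of_hasStrictFDerivAt hq
      (HasStrictFDerivAt.comp (f := fun Z : Matrix n n ℝ => Z * Zᵀ) Y hG hsq)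
  have hBY : (∑ i, l i • A i + l₀ • G) * Y = 0 := by
    have hB : (∑ i, l i • A i + l₀ • G).IsSymm := by
      simp [Matrix.IsSymm, transpose_sum, (hA _).eq, hGs.eq]
    apply eq_zero_of_trace_mul_transpose_self
    have h := trace_mul_mulTransposeDeriv hB Y ((∑ i, l i • A i + l₀ • G) * Y)
    have h0 : ((∑ i, l i • A i + l₀ • G) *
        mulTransposeDeriv Y ((∑ i, l i • A i + l₀ • G) * Y)).trace = 0 := by
      have := DFunLike.congr_fun hsum ((∑ i, l i • A i + l₀ • G) * Y)
      rw [Matrix.add_mul, trace_add, Matrix.sum_mul, trace_sum]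
      simpa [-mulTransposeDeriv_apply] using! this
    linarith
  have hl₀ : l₀ ≠ 0 := by
    rintro rfl
    apply hne
    have := Fintype.linearIndependent_iff.1 hindep l (by simpa [Matrix.sum_mul] using hBY)
    simpa [Prod.ext_iff, funext_iff] using this
  refine ⟨fun i => -(l i / l₀), ?_⟩
  have h : G - ∑ i, -(l i / l₀) • A i = l₀⁻¹ • (∑ i, l i • A i + l₀ • G) := by
    rw [smul_add, smul_smul, inv_mul_cancel₀ hl₀, one_smul, Finset.smul_sum]
    simp [smul_smul, div_eq_inv_mul, add_comm]
  rw [h, Matrix.smul_mul, hBY, smul_zero]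

/-- Under the independence condition, the constraint map restricted to
`Y + span (A₁ Y, …, A_m Y)` is a local diffeomorphism. -/
theorem exists_equiv_hasStrictFDerivAt_constraint {A : ι → Matrix n n ℝ}
    (hA : ∀ i, (A i).IsSymm) {Y : Matrix n n ℝ}
    (hindep : LinearIndependent ℝ (fun i => A i * Y)) :
    ∃ e : (ι → ℝ) ≃L[ℝ] (ι → ℝ),
      (∀ c i, e c i = 2 * (A i * Y * (∑ j, c j • (A j * Y))ᵀ).trace) ∧
      HasStrictFDerivAt (fun (c : ι → ℝ) i =>
        (A i * ((Y + ∑ j, c j • (A j * Y)) * (Y + ∑ j, c j • (A j * Y))ᵀ)).trace)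
        (e : (ι → ℝ) →L[ℝ] (ι → ℝ)) 0 := by
  let P : (ι → ℝ) →L[ℝ] Matrix n n ℝ :=
    LinearMap.toContinuousLinearMap (Fintype.linearCombination ℝ (fun j => A j * Y))
  have hP (c : ι → ℝ) : P c = ∑ j, c j • (A j * Y) := rfl
  let D : (ι → ℝ) →L[ℝ] (ι → ℝ) :=
    ContinuousLinearMap.pi fun i => traceMulLeft (A i) ∘L mulTransposeDeriv Y ∘L P
  have hD (c i) : D c i = 2 * (A i * Y * (P c)ᵀ).trace :=
    trace_mul_mulTransposeDeriv (hA i) Y (P c)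
  have hinj : Function.Injective D := by
    rw [injective_iff_map_eq_zero]
    intro c hc
    have h0 (i : ι) : (A i * Y * (P c)ᵀ).trace = 0 := by
      have := congr_fun hc i
      rw [hD] at this
      simpa using this
    have hPc : P c = 0 := by
      apply eq_zero_of_trace_mul_transpose_self
      nth_rw 1 [hP]
      simp [Matrix.sum_mul, h0]
    exact funext (Fintype.linearIndependent_iff.1 hindep c hPc)
  let e := (LinearEquiv.ofInjectiveEndo (D : (ι → ℝ) →ₗ[ℝ] (ι → ℝ)) hinj).toContinuousLinearEquiv
  have he : (e : (ι → ℝ) →L[ℝ] (ι → ℝ)) = D := by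
    ext1 c
    rfl
  refine ⟨e, fun c i => hD c i, ?_⟩
  rw [he, hasStrictFDerivAt_pi']
  intro i
  have hW : HasStrictFDerivAt (fun c => Y + P c) P 0 := P.hasStrictFDerivAt.const_add Y
  have hsq : HasStrictFDerivAt (fun Z : Matrix n n ℝ => Z * Zᵀ) (mulTransposeDeriv Y)
      (Y + P 0) := by
    simpa using hasStrictFDerivAt_mul_transpose_self Y
  exact (traceMulLeft (A i)).hasStrictFDerivAt.comp 0 (hsq.comp 0 hW)

/-- Second-order condition for the factorized program, along a direction `U` whose rows lie in the
kernel of `Y`. -/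
theorem trace_mul_mul_transpose_nonneg {A : ι → Matrix n n ℝ} {b : ι → ℝ}
    (hA : ∀ i, (A i).IsSymm) {f : Matrix n n ℝ → ℝ} {Y G : Matrix n n ℝ} (hGs : G.IsSymm)
    (hG : HasStrictFDerivAt f (traceMulLeft G) (Y * Yᵀ))
    (hfeas : ∀ i, (A i * (Y * Yᵀ)).trace = b i)
    (hmin : IsLocalMinOn (fun Z : Matrix n n ℝ => f (Z * Zᵀ))
      {Z | ∀ i, (A i * (Z * Zᵀ)).trace = b i} Y)
    (hindep : LinearIndependent ℝ (fun i => A i * Y))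
    {l : ι → ℝ} (hl : (G - ∑ i, l i • A i) * Y = 0)
    {U : Matrix n n ℝ} (hU : Y * Uᵀ = 0) :
    0 ≤ ((G - ∑ i, l i • A i) * (U * Uᵀ)).trace := by
  obtain ⟨e, he, hq⟩ := exists_equiv_hasStrictFDerivAt_constraint hA hindep
  let P : (ι → ℝ) →L[ℝ] Matrix n n ℝ :=
    LinearMap.toContinuousLinearMap (Fintype.linearCombination ℝ (fun j => A j * Y))
  have hP (c : ι → ℝ) : P c = ∑ j, c j • (A j * Y) := rfl
  simp only [← hP] at he hq
  let q : (ι → ℝ) → ι → ℝ := fun c i => (A i * ((Y + P c) * (Y + P c)ᵀ)).trace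
  change HasStrictFDerivAt q _ 0 at hq
  have hq0 : q 0 = b := by
    ext i
    simp [q, hfeas]
  let a : ι → ℝ := fun i => (A i * (U * Uᵀ)).trace
  let c : ℝ → ι → ℝ := fun s => hq.localInverse q e 0 (b - s • a)
  have hline : HasDerivAt (fun s : ℝ => b - s • a) (-a) 0 := by
    simpa using ((hasDerivAt_id (0 : ℝ)).smul_const a).const_sub b
  have hc0 : c 0 = 0 := by
    have := hq.localInverse_apply_image
    rw [hq0] at this
    simpa [c] using this
  have hc : HasDerivAt c (e.symm (-a)) 0 := by
    have h := hq.to_localInverse.hasFDerivAt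
    rw [hq0] at h
    have h' : HasFDerivAt (hq.localInverse q e 0) (e.symm : (ι → ℝ) →L[ℝ] (ι → ℝ))
        (b - (0 : ℝ) • a) := by simpa using h
    exact h'.comp_hasDerivAt 0 hline
  have hqc : ∀ᶠ s in 𝓝 (0 : ℝ), q (c s) = b - s • a := by
    have h := hq.eventually_right_inverse
    rw [hq0] at h
    have ht : Tendsto (fun s : ℝ => b - s • a) (𝓝 0) (𝓝 b) := by
      simpa using hline.continuousAt.tendsto
    exact ht.eventually h
  have hPU (x : ι → ℝ) : (Y + P x) * Uᵀ = 0 := by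
    simp [hP, Matrix.add_mul, hU, Matrix.sum_mul, Matrix.mul_assoc]
  have hUP (x : ι → ℝ) : U * (Y + P x)ᵀ = 0 := by
    rw [← transpose_transpose U, ← transpose_mul, hPU, transpose_zero]
  let W : ℝ → Matrix n n ℝ := fun s => Y + P (c s) + √s • U
  let V : ℝ → Matrix n n ℝ := fun s => (Y + P (c s)) * (Y + P (c s))ᵀ + s • (U * Uᵀ)
  have hWV {s : ℝ} (hs : 0 ≤ s) : W s * (W s)ᵀ = V s := by
    simp only [W, V]
    rw [transpose_add (Y + P (c s)), Matrix.add_mul (Y + P (c s)), Matrix.mul_add, Matrix.mul_add,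
      transpose_smul, Matrix.mul_smul, hPU, Matrix.smul_mul, hUP, Matrix.smul_mul, Matrix.mul_smul,
      smul_smul, Real.mul_self_sqrt hs]
    simp
  have hV0 : V 0 = Y * Yᵀ := by simp [V, hc0]
  have hW0 : Tendsto W (𝓝 0) (𝓝 Y) := by
    have hcont : ContinuousAt W 0 :=
      (continuousAt_const.add (P.continuous.continuousAt.comp hc.continuousAt)).add
        (Real.continuous_sqrt.continuousAt.smul continuousAt_const)
    simpa [W, hc0] using hcont.tendsto
  have hge : ∀ᶠ s in 𝓝[≥] (0 : ℝ), f (V 0) ≤ f (V s) := by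
    have hWmin := hW0.eventually (eventually_nhdsWithin_iff.1 hmin)
    filter_upwards [mem_nhdsWithin_of_mem_nhds hWmin, mem_nhdsWithin_of_mem_nhds hqc,
      self_mem_nhdsWithin] with s hs hqs hs0
    have h := hs fun i => by
      rw [hWV hs0]
      simp only [V]
      have := congr_fun hqs i
      simp only [q, a, Pi.sub_apply, Pi.smul_apply, smul_eq_mul] at this
      rw [Matrix.mul_add, trace_add, this]
      simp
    rw [hWV hs0] at h
    rwa [hV0]
  have hVd : HasDerivAt V (mulTransposeDeriv Y (P (e.symm (-a))) + U * Uᵀ) 0 := by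
    have hsq : HasFDerivAt (fun Z : Matrix n n ℝ => Z * Zᵀ) (mulTransposeDeriv Y)
        (Y + P (c 0)) := by
      simpa [hc0] using (hasStrictFDerivAt_mul_transpose_self Y).hasFDerivAt
    have h1 : HasDerivAt (fun s => Y + P (c s)) (P (e.symm (-a))) 0 :=
      (P.hasFDerivAt.comp_hasDerivAt 0 hc).const_add Y
    have h2 : HasDerivAt (fun s : ℝ => s • (U * Uᵀ)) (U * Uᵀ) 0 := by
      simpa only [one_smul] using! (hasDerivAt_id (0 : ℝ)).smul_const (U * Uᵀ)
    exact (hsq.comp_hasDerivAt 0 h1).add h2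
  have hfd : HasDerivAt (f ∘ V)
      (traceMulLeft G (mulTransposeDeriv Y (P (e.symm (-a))) + U * Uᵀ)) 0 := by
    rw [← hV0] at hG
    exact hG.hasFDerivAt.comp_hasDerivAt 0 hVd
  have hnn : 0 ≤ traceMulLeft G (mulTransposeDeriv Y (P (e.symm (-a))) + U * Uᵀ) := by
    have hmin0 : IsLocalMinOn (f ∘ V) (Set.Ici 0) 0 := hge
    have := hmin0.hasFDerivWithinAt_nonneg (y := 1) hfd.hasFDerivAt.hasFDerivWithinAt
      (mem_posTangentConeAt_of_segment_subset (by
        rw [segment_eq_Icc (by norm_num)]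
        exact fun x hx => by simpa using hx.1))
    simpa using this
  have hGY : G * Y = ∑ i, l i • (A i * Y) := by
    rw [Matrix.sub_mul, sub_eq_zero] at hl
    simpa [Matrix.sum_mul] using hl
  have hcorr : (G * mulTransposeDeriv Y (P (e.symm (-a)))).trace = -∑ i, l i * a i := by
    rw [trace_mul_mulTransposeDeriv hGs, hGY, Matrix.sum_mul, trace_sum, Finset.mul_sum,
      ← Finset.sum_neg_distrib]
    refine Finset.sum_congr rfl fun i _ => ?_
    have h := he (e.symm (-a)) i
    rw [e.apply_symm_apply, Pi.neg_apply] at h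
    rw [Matrix.smul_mul, trace_smul, smul_eq_mul]
    linear_combination -(l i) * h
  rw [traceMulLeft_apply, Matrix.mul_add, trace_add, hcorr] at hnn
  rw [Matrix.sub_mul, trace_sub, Matrix.sum_mul, trace_sum]
  simp only [Matrix.smul_mul, trace_smul, smul_eq_mul]
  simp only [a] at hnn
  linarith

end

/-- Corollary 1 (full-dimension case p = n): any local minimizer
`Y ∈ ℝ^{n×n}` of the factorized program yields a global minimizer `X = YYᵀ`
of the convex program (P). -/
theorem full_dimension_local_min_is_global {n m : ℕ}
    (A : Fin m → Matrix (Fin n) (Fin n) ℝ) (b : Fin m → ℝ)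
    (hA : ∀ i, (A i).IsSymm)
    (f : Matrix (Fin n) (Fin n) ℝ → ℝ)
    (g : Matrix (Fin n) (Fin n) ℝ → Matrix (Fin n) (Fin n) ℝ)
    (hf_conv : ConvexOn ℝ Set.univ f)
    (hf : ContDiff ℝ 2 f)
    (hg_symm : ∀ X : Matrix (Fin n) (Fin n) ℝ, X.IsSymm → (g X).IsSymm)
    (hgrad : ∀ X H : Matrix (Fin n) (Fin n) ℝ,
      HasDerivAt (fun t : ℝ => f (X + t • H)) ((g X * H).trace) 0)
    (Y : Matrix (Fin n) (Fin n) ℝ)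
    (hfeas : ∀ i, (Yᵀ * A i * Y).trace = b i)
    (hmin : IsLocalMinOn (fun Y' : Matrix (Fin n) (Fin n) ℝ => f (Y' * Y'ᵀ))
      {Y' : Matrix (Fin n) (Fin n) ℝ | ∀ i, (Y'ᵀ * A i * Y').trace = b i} Y)
    (hindep : LinearIndependent ℝ (fun i => A i * Y)) :
    ∀ X' : Matrix (Fin n) (Fin n) ℝ, X'.PosSemidef →
      (∀ i, (A i * X').trace = b i) → f X' ≥ f (Y * Yᵀ) := by
  intro X' hX' hfeas'
  simp only [trace_transpose_mul_mul] at hfeas hmin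
  set G := g (Y * Yᵀ)
  have hGs : G.IsSymm := hg_symm _ (by simp [Matrix.IsSymm])
  have hG := hasStrictFDerivAt_traceMulLeft hf (hgrad (Y * Yᵀ))
  obtain ⟨l, hl⟩ := exists_multipliers_mul_eq_zero hA hGs hG hfeas hmin hindep
  have hSX : 0 ≤ ((G - ∑ i, l i • A i) * X').trace := by
    by_cases hdet : Y.det = 0
    · obtain ⟨z, hz, hYz⟩ := exists_mulVec_eq_zero_iff.2 hdet
      obtain ⟨k, v, rfl⟩ := posSemidef_iff_eq_sum_vecMulVec.1 hX'
      rw [Matrix.mul_sum, trace_sum]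
      refine Finset.sum_nonneg fun j _ => ?_
      have hU : Y * (vecMulVec (v j) z)ᵀ = 0 := by
        rw [transpose_vecMulVec, mul_vecMulVec, hYz, zero_vecMulVec]
      have h := trace_mul_mul_transpose_nonneg hA hGs hG hfeas hmin hindep hl hU
      rw [transpose_vecMulVec, vecMulVec_mul_vecMulVec, vecMulVec_smul, Matrix.mul_smul,
        trace_smul, smul_eq_mul] at h
      have hzz : 0 < z ⬝ᵥ z := by simpa using dotProduct_star_self_pos_iff.2 hz
      simpa using nonneg_of_mul_nonneg_right h hzz
    · have hS : G - ∑ i, l i • A i = 0 := by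
        rw [← mul_nonsing_inv_cancel_right Y (G - ∑ i, l i • A i) (isUnit_iff_ne_zero.2 hdet), hl,
          Matrix.zero_mul]
      simp [hS]
  have hgap : (G * (X' - Y * Yᵀ)).trace = ((G - ∑ i, l i • A i) * X').trace := by
    have h : ((G - ∑ i, l i • A i) * (X' - Y * Yᵀ)).trace =
        ((G - ∑ i, l i • A i) * X').trace := by
      rw [Matrix.mul_sub, ← Matrix.mul_assoc _ Y, hl, Matrix.zero_mul, sub_zero]
    rw [← h, Matrix.sub_mul, trace_sub, Matrix.sum_mul, trace_sum]
    simp [Matrix.mul_sub, hfeas, hfeas']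
  have h := hf_conv.add_trace_le (X' - Y * Yᵀ) (hgrad (Y * Yᵀ) _)
  rw [add_sub_cancel] at h
  change f (Y * Yᵀ) + (G * (X' - Y * Yᵀ)).trace ≤ f X' at h
  linarith
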